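/- Let G be a strictly unimodal uniform (SU²) grid and i ∈ [0,N]. The degree-d Z*-closure of the weight-determined set T_{N,i} = [0,i−1] ∪ [N−i+1,N] equals T_{N,i} if i ≤ d, and equals all of [0,N] if i > d. -/

import Mathlib

/-- The uniform grid `[0,k₁-1] × ⋯ × [0,kₙ-1]`, as a subset of `ℝⁿ`. -/
def gridSetR (n : ℕ) (k : Fin n → ℕ) : Set (Fin n → ℝ) :=
  {x | ∀ i, ∃ a : ℕ, a < k i ∧ x i = a}

/-- The weight-determined set `E̲ = {x ∈ G : wt(x) ∈ E}`, as a subset of `ℝⁿ`. -/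
def underlineR (n : ℕ) (k : Fin n → ℕ) (E : Set ℕ) : Set (Fin n → ℝ) :=
  {x | x ∈ gridSetR n k ∧ ∃ e ∈ E, ∑ i, x i = (e : ℝ)}

/-- The degree-`d` Zariski closure of `A` in the grid. -/
def ZclR (n : ℕ) (k : Fin n → ℕ) (d : ℕ) (A : Set (Fin n → ℝ)) : Set (Fin n → ℝ) :=
  {x | x ∈ gridSetR n k ∧ ∀ p : MvPolynomial (Fin n) ℝ, p.totalDegree ≤ d →
    (∀ a ∈ A, MvPolynomial.eval a p = 0) → MvPolynomial.eval x p = 0}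

/-- The degree-`d` Z*-closure of a weight-determined set `E̲`, identified with a subset of
`[0,N]`: the set of weights `j` whose entire layer lies in the degree-`d` Zariski closure. -/
def ZstarR (n : ℕ) (k : Fin n → ℕ) (N d : ℕ) (E : Set ℕ) : Set ℕ :=
  {j | j ≤ N ∧ underlineR n k {j} ⊆ ZclR n k d (underlineR n k E)}

/-- The number of grid points of weight `j`. -/
noncomputable def layerCard (n : ℕ) (k : Fin n → ℕ) (j : ℕ) : ℕ :=
  (Finset.univ.filter (fun x : ∀ i, Fin (k i) => ∑ i, (x i : ℕ) = j)).card


noncomputable def bcz (M : ℕ) (z : ℤ) : ℝ := if 0 ≤ z then (M.choose z.toNat : ℝ) else 0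

lemma bcz_neg (M : ℕ) (z : ℤ) (h : z < 0) : bcz M z = 0 := by
  simp [bcz, not_le.mpr h]

lemma bcz_gt (M : ℕ) (z : ℤ) (h : (M : ℤ) < z) : bcz M z = 0 := by
  unfold bcz
  split_ifs
  · rw [Nat.choose_eq_zero_of_lt (by omega)]; simp
  · rfl

lemma bcz_pascal (M : ℕ) (z : ℤ) : bcz (M + 1) z = bcz M z + bcz M (z - 1) := by
  rcases lt_trichotomy z 0 with h | h | h
  · rw [bcz_neg _ _ h, bcz_neg _ _ h, bcz_neg _ _ (by omega)]; simp
  · subst h; simp [bcz]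
  · obtain ⟨t, rfl⟩ : ∃ t : ℕ, z = t + 1 := ⟨(z - 1).toNat, by omega⟩
    have h1 : (0 : ℤ) ≤ t + 1 := by omega
    have h2 : ((t : ℤ) + 1).toNat = t + 1 := by omega
    simp only [bcz, h1, h2, if_true, add_sub_cancel_right, Int.toNat_natCast, Nat.cast_nonneg,
      Nat.choose_succ_succ]
    push_cast; ring

inductive RepF : ℕ → ℕ → ℕ → ℕ → (ℤ → ℤ → ℤ → ℝ) → Prop
  | basis (t1 t2 t3 r1 r2 r3 : ℕ) : RepF (t1 + t2 + t3) (t1 + r1) (t2 + r2) (t3 + r3)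
      (fun u w v => bcz r1 (u - t1) * bcz r2 (w - t2) * bcz r3 (v - t3))
  | sub (d A B C : ℕ) (F G : ℤ → ℤ → ℤ → ℝ) : RepF d A B C F → RepF d A B C G →
      RepF d A B C (fun u w v => F u w v - G u w v)

lemma RepF.basis' {d A B C : ℕ} {F : ℤ → ℤ → ℤ → ℝ} (t1 t2 t3 r1 r2 r3 : ℕ)
    (hd : d = t1 + t2 + t3) (hA : A = t1 + r1) (hB : B = t2 + r2) (hC : C = t3 + r3)
    (hF : ∀ u w v, F u w v = bcz r1 (u - t1) * bcz r2 (w - t2) * bcz r3 (v - t3)) :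
    RepF d A B C F := by
  have : F = (fun u w v => bcz r1 (u - t1) * bcz r2 (w - t2) * bcz r3 (v - t3)) := by
    funext u w v; exact hF u w v
  subst hd hA hB hC this
  exact RepF.basis ..

lemma RepF.sub' {d A B C : ℕ} {H F G : ℤ → ℤ → ℤ → ℝ} (hF : RepF d A B C F) (hG : RepF d A B C G)
    (h : ∀ u w v, H u w v = F u w v - G u w v) : RepF d A B C H := by
  have : H = (fun u w v => F u w v - G u w v) := by funext u w v; exact h u w v
  subst this
  exact RepF.sub _ _ _ _ _ _ hF hG

lemma RepF.swap12 {d A B C : ℕ} {F : ℤ → ℤ → ℤ → ℝ} (h : RepF d A B C F) :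
    RepF d B A C (fun u w v => F w u v) := by
  induction h with
  | basis t1 t2 t3 r1 r2 r3 =>
    exact RepF.basis' t2 t1 t3 r2 r1 r3 (by omega) rfl rfl rfl (by intros; ring)
  | sub d A B C F G _ _ h1 h2 => exact h1.sub' h2 (by intros; rfl)

lemma RepF.swap23 {d A B C : ℕ} {F : ℤ → ℤ → ℤ → ℝ} (h : RepF d A B C F) :
    RepF d A C B (fun u w v => F u v w) := by
  induction h with
  | basis t1 t2 t3 r1 r2 r3 =>
    exact RepF.basis' t1 t3 t2 r1 r3 r2 (by omega) rfl rfl rfl (by intros; ring)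
  | sub d A B C F G _ _ h1 h2 => exact h1.sub' h2 (by intros; rfl)

lemma RepF.D12 {d A B C : ℕ} {F : ℤ → ℤ → ℤ → ℝ} (h : RepF d A B C F) :
    RepF (d + 1) (A + 1) (B + 1) C (fun u w v => F (u - 1) w v - F u (w - 1) v) := by
  induction h with
  | basis t1 t2 t3 r1 r2 r3 =>
    have h1 : RepF (t1 + t2 + t3 + 1) (t1 + r1 + 1) (t2 + r2 + 1) (t3 + r3) _ :=
      RepF.basis' (t1 + 1) t2 t3 r1 (r2 + 1) r3 (by omega) (by omega) (by omega) rfl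
        (fun _ _ _ => rfl)
    have h2 : RepF (t1 + t2 + t3 + 1) (t1 + r1 + 1) (t2 + r2 + 1) (t3 + r3) _ :=
      RepF.basis' t1 (t2 + 1) t3 (r1 + 1) r2 r3 (by omega) (by omega) (by omega) rfl
        (fun _ _ _ => rfl)
    refine h1.sub' h2 ?_
    intro u w v
    simp only [bcz_pascal]
    have e1 : u - ((t1 + 1 : ℕ) : ℤ) = u - t1 - 1 := by push_cast; ring
    have e2 : w - ((t2 + 1 : ℕ) : ℤ) = w - t2 - 1 := by push_cast; ring
    have e3 : u - 1 - (t1 : ℤ) = u - t1 - 1 := by ring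
    have e4 : w - 1 - (t2 : ℤ) = w - t2 - 1 := by ring
    rw [e1, e2, e3, e4]
    ring
  | sub d A B C F G _ _ h1 h2 => exact h1.sub' h2 (by intros; ring)

lemma RepF.D23 {d A B C : ℕ} {F : ℤ → ℤ → ℤ → ℝ} (h : RepF d A B C F) :
    RepF (d + 1) A (B + 1) (C + 1) (fun u w v => F u (w - 1) v - F u w (v - 1)) :=
  (h.swap12.swap23.D12).swap23.swap12

lemma RepF.D13 {d A B C : ℕ} {F : ℤ → ℤ → ℤ → ℝ} (h : RepF d A B C F) :
    RepF (d + 1) (A + 1) B (C + 1) (fun u w v => F (u - 1) w v - F u w (v - 1)) :=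
  h.swap23.D12.swap23

lemma key_exists (A0 B0 C0 a b e : ℕ) : ∃ F : ℤ → ℤ → ℤ → ℝ,
    RepF (a + b + e) (A0 + a + b) (B0 + b + e) (C0 + a + e) F ∧
    (∀ u w v : ℤ, u + w + v < (a + b + e : ℕ) → F u w v = 0) ∧
    (∀ u w v : ℤ, (A0 + B0 + C0 + a + b + e : ℕ) < u + w + v → F u w v = 0) ∧
    (∀ u w v : ℤ, v < 0 → F u w v = 0) ∧
    (∀ u w v : ℤ, (A0 + a + b : ℕ) < u → F u w v = 0) ∧
    (∀ w : ℤ, F (A0 + a + b : ℕ) w 0 = bcz B0 (w - e)) := by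
  induction a with
  | succ a ih =>
    obtain ⟨F, h1, h2, h3, h4, h5, h6⟩ := ih
    refine ⟨fun u w v => F (u - 1) w v - F u w (v - 1), ?_, ?_, ?_, ?_, ?_, ?_⟩
    · convert h1.D13 using 1 <;> omega
    · intro u w v h
      simp only
      rw [h2 _ _ _ (by push_cast at *; omega), h2 _ _ _ (by push_cast at *; omega), sub_zero]
    · intro u w v h
      simp only
      rw [h3 _ _ _ (by push_cast at *; omega), h3 _ _ _ (by push_cast at *; omega), sub_zero]
    · intro u w v h
      simp only
      rw [h4 _ _ _ (by omega), h4 _ _ _ (by omega), sub_zero]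
    · intro u w v h
      simp only
      rw [h5 _ _ _ (by push_cast at *; omega), h5 _ _ _ (by push_cast at *; omega), sub_zero]
    · intro w
      simp only
      rw [h4 _ _ (0 - 1) (by omega), ← h6, sub_zero]
      congr 1; push_cast; ring
  | zero =>
    induction b with
    | succ b ih =>
      obtain ⟨F, h1, h2, h3, h4, h5, h6⟩ := ih
      refine ⟨fun u w v => F (u - 1) w v - F u (w - 1) v, ?_, ?_, ?_, ?_, ?_, ?_⟩
      · convert h1.D12 using 1 <;> omega
      · intro u w v h
        simp only
        rw [h2 _ _ _ (by push_cast at *; omega), h2 _ _ _ (by push_cast at *; omega), sub_zero]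
      · intro u w v h
        simp only
        rw [h3 _ _ _ (by push_cast at *; omega), h3 _ _ _ (by push_cast at *; omega), sub_zero]
      · intro u w v h
        simp only
        rw [h4 _ _ _ (by omega), h4 _ _ _ (by omega), sub_zero]
      · intro u w v h
        simp only
        rw [h5 _ _ _ (by push_cast at *; omega), h5 _ _ _ (by push_cast at *; omega), sub_zero]
      · intro w
        simp only
        rw [h5 _ (w - 1) 0 (by push_cast; omega), ← h6, sub_zero]
        congr 1; push_cast; ring
    | zero =>
      induction e with
      | succ e ih =>
        obtain ⟨F, h1, h2, h3, h4, h5, h6⟩ := ih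
        refine ⟨fun u w v => F u (w - 1) v - F u w (v - 1), ?_, ?_, ?_, ?_, ?_, ?_⟩
        · convert h1.D23 using 1 <;> omega
        · intro u w v h
          simp only
          rw [h2 _ _ _ (by push_cast at *; omega), h2 _ _ _ (by push_cast at *; omega), sub_zero]
        · intro u w v h
          simp only
          rw [h3 _ _ _ (by push_cast at *; omega), h3 _ _ _ (by push_cast at *; omega), sub_zero]
        · intro u w v h
          simp only
          rw [h4 _ _ _ (by omega), h4 _ _ _ (by omega), sub_zero]
        · intro u w v h
          simp only
          rw [h5 _ _ _ (by push_cast at *; omega), h5 _ _ _ (by push_cast at *; omega), sub_zero]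
        · intro w
          simp only
          rw [h4 _ _ (0 - 1) (by omega), h6, sub_zero]
          congr 1; push_cast; ring
      | zero =>
        refine ⟨fun u w v => bcz A0 u * bcz B0 w * bcz C0 v, ?_, ?_, ?_, ?_, ?_, ?_⟩
        · exact RepF.basis' 0 0 0 A0 B0 C0 rfl (by simp) (by simp) (by simp) (by simp)
        · intro u w v h
          simp only
          rcases lt_or_ge u 0 with h0 | h0
          · rw [bcz_neg _ _ h0]; simp
          rcases lt_or_ge w 0 with h1 | h1
          · rw [bcz_neg _ _ h1]; simp
          rw [bcz_neg _ v (by push_cast at h; omega)]; simp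
        · intro u w v h
          simp only
          rcases lt_or_ge (A0 : ℤ) u with h0 | h0
          · rw [bcz_gt _ _ h0]; simp
          rcases lt_or_ge (B0 : ℤ) w with h1 | h1
          · rw [bcz_gt _ _ h1]; simp
          rw [bcz_gt _ v (by push_cast at h; omega)]; simp
        · intro u w v h
          simp only
          rw [bcz_neg _ _ h]; simp
        · intro u w v h
          simp only
          rw [bcz_gt _ u (by push_cast at h; omega)]; simp
        · intro w
          simp [bcz]

noncomputable def dpL {n : ℕ} (L : MvPolynomial (Fin n) ℝ) : ℕ → MvPolynomial (Fin n) ℝ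
  | 0 => 1
  | t + 1 => dpL L t * (L - MvPolynomial.C (t : ℝ))

lemma dpL_deg {n : ℕ} (L : MvPolynomial (Fin n) ℝ) (hL : L.totalDegree ≤ 1) (t : ℕ) :
    (dpL L t).totalDegree ≤ t := by
  induction t with
  | zero => simp [dpL]
  | succ t ih =>
    refine (MvPolynomial.totalDegree_mul _ _).trans (add_le_add ih ?_)
    refine (MvPolynomial.totalDegree_sub _ _).trans ?_
    rw [MvPolynomial.totalDegree_C]; exact max_le hL (by omega)

lemma dpL_eval {n : ℕ} (L : MvPolynomial (Fin n) ℝ) (x : Fin n → ℝ) (u : ℕ)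
    (hu : MvPolynomial.eval x L = u) (t : ℕ) :
    MvPolynomial.eval x (dpL L t) = (u.descFactorial t : ℝ) := by
  induction t with
  | zero => simp [dpL]
  | succ t ih =>
    simp only [dpL, map_mul, map_sub, ih, hu, MvPolynomial.eval_C, Nat.descFactorial_succ]
    rcases le_or_gt t u with h | h
    · push_cast [Nat.cast_sub h]; ring
    · rw [Nat.descFactorial_eq_zero_iff_lt.mpr h]; simp

lemma bcz_desc (t r u : ℕ) :
    bcz r ((u : ℤ) - t) = ((t + r).choose u : ℝ) *
      ((((t + r).descFactorial t : ℕ) : ℝ)⁻¹ * (u.descFactorial t : ℝ)) := by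
  have h0 : (((t + r).descFactorial t : ℕ) : ℝ) ≠ 0 := by
    have : (t + r).descFactorial t ≠ 0 := by
      rw [Ne, Nat.descFactorial_eq_zero_iff_lt]; omega
    exact_mod_cast this
  rcases lt_or_ge u t with h | h
  · rw [bcz_neg _ _ (by omega), Nat.descFactorial_eq_zero_iff_lt.mpr h]; simp
  · have e1 : bcz r ((u : ℤ) - t) = (r.choose (u - t) : ℝ) := by
      rw [bcz, if_pos (by omega)]; congr 2; omega
    rw [e1]
    have key : (t + r).choose u * u.descFactorial t = r.choose (u - t) * (t + r).descFactorial t := by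
      rcases le_or_gt u (t + r) with h2 | h2
      · have := Nat.choose_mul (n := t + r) (k := u) (s := t) h
        rw [Nat.descFactorial_eq_factorial_mul_choose, Nat.descFactorial_eq_factorial_mul_choose]
        rw [show t + r - t = r by omega] at this
        calc _ = t.factorial * ((t + r).choose u * u.choose t) := by ring
          _ = _ := by rw [this]; ring
      · rw [Nat.choose_eq_zero_of_lt h2, Nat.choose_eq_zero_of_lt (by omega)]; simp
    have key' : ((t + r).choose u : ℝ) * (u.descFactorial t : ℝ) =
      (r.choose (u - t) : ℝ) * (((t + r).descFactorial t : ℕ) : ℝ) := by exact_mod_cast key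
    field_simp
    linarith

lemma RepF.poly {d A B C : ℕ} {F : ℤ → ℤ → ℤ → ℝ} (h : RepF d A B C F) {n : ℕ}
    (LU LW LV : MvPolynomial (Fin n) ℝ) (hU : LU.totalDegree ≤ 1) (hW : LW.totalDegree ≤ 1)
    (hV : LV.totalDegree ≤ 1) :
    ∃ p : MvPolynomial (Fin n) ℝ, p.totalDegree ≤ d ∧ ∀ (x : Fin n → ℝ) (u w v : ℕ),
      MvPolynomial.eval x LU = u → MvPolynomial.eval x LW = w → MvPolynomial.eval x LV = v →
      F u w v = ((A.choose u : ℝ) * B.choose w * C.choose v) * MvPolynomial.eval x p := by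
  induction h with
  | basis t1 t2 t3 r1 r2 r3 =>
    refine ⟨MvPolynomial.C (((((t1 + r1).descFactorial t1 : ℕ) : ℝ)⁻¹ *
      (((t2 + r2).descFactorial t2 : ℕ) : ℝ)⁻¹ * (((t3 + r3).descFactorial t3 : ℕ) : ℝ)⁻¹)) *
      (dpL LU t1 * dpL LW t2 * dpL LV t3), ?_, ?_⟩
    · refine (MvPolynomial.totalDegree_mul _ _).trans ?_
      rw [MvPolynomial.totalDegree_C, zero_add]
      refine (MvPolynomial.totalDegree_mul _ _).trans (add_le_add ?_ (dpL_deg _ hV _))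
      exact (MvPolynomial.totalDegree_mul _ _).trans (add_le_add (dpL_deg _ hU _) (dpL_deg _ hW _))
    · intro x u w v h1 h2 h3
      simp only [map_mul, MvPolynomial.eval_C, dpL_eval _ _ _ h1, dpL_eval _ _ _ h2,
        dpL_eval _ _ _ h3, bcz_desc]
      ring
  | sub d A B C F G _ _ h1 h2 =>
    obtain ⟨p, hp, hp'⟩ := h1
    obtain ⟨q, hq, hq'⟩ := h2
    refine ⟨p - q, (MvPolynomial.totalDegree_sub _ _).trans (max_le hp hq), ?_⟩
    intro x u w v a1 a2 a3
    simp only [map_sub]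
    rw [hp' x u w v a1 a2 a3, hq' x u w v a1 a2 a3]
    ring

lemma alt_sum_pow (y a : ℕ) (h : a < y) :
    ∑ z ∈ Finset.range (y + 1), ((-1 : ℝ) ^ (y - z) * (y.choose z : ℝ)) * (z : ℝ) ^ a = 0 := by
  have h1 := fwdDiff_iter_eq_sum_shift (1 : ℝ) (fun r : ℝ => r ^ a) y 0
  rw [fwdDiff_iter_pow_eq_zero_of_lt h] at h1
  simp only [Pi.zero_apply] at h1
  rw [h1]
  refine Finset.sum_congr rfl fun z _ => ?_
  simp

lemma alt_sum_poly {n d : ℕ} (p : MvPolynomial (Fin n) ℝ) (hp : p.totalDegree ≤ d)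
    (y : Fin n → ℕ) (hy : d < ∑ i, y i) :
    ∑ z ∈ Fintype.piFinset (fun i => Finset.range (y i + 1)),
      (∏ i, ((-1 : ℝ) ^ (y i - z i) * ((y i).choose (z i) : ℝ))) *
        MvPolynomial.eval (fun i => (z i : ℝ)) p = 0 := by
  simp only [MvPolynomial.eval_eq', Finset.mul_sum]
  rw [Finset.sum_comm]
  refine Finset.sum_eq_zero fun a ha => ?_
  have hdeg : ∑ i, a i ≤ d := by
    have := (MvPolynomial.le_totalDegree ha).trans hp
    rwa [Finsupp.sum_fintype _ _ (by simp)] at this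
  obtain ⟨i, hi⟩ : ∃ i, a i < y i := by
    by_contra hcon
    push Not at hcon
    have := Finset.sum_le_sum (s := Finset.univ) (fun i _ => hcon i)
    omega
  have : ∀ z : Fin n → ℕ, (∏ i, ((-1 : ℝ) ^ (y i - z i) * ((y i).choose (z i) : ℝ))) *
      (MvPolynomial.coeff a p * ∏ i, (z i : ℝ) ^ a i) = MvPolynomial.coeff a p *
      ∏ i, (((-1 : ℝ) ^ (y i - z i) * ((y i).choose (z i) : ℝ)) * (z i : ℝ) ^ a i) := by
    intro z
    rw [Finset.prod_mul_distrib (g := fun i => (z i : ℝ) ^ a i)]; ring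
  simp only [this]
  rw [← Finset.mul_sum, ← Finset.prod_univ_sum (fun i => Finset.range (y i + 1))
    (fun i z => ((-1 : ℝ) ^ (y i - z) * ((y i).choose z : ℝ)) * (z : ℝ) ^ a i),
    Finset.prod_eq_zero (Finset.mem_univ i) (alt_sum_pow _ _ hi), mul_zero]

lemma vanish_all {n d : ℕ} (k : Fin n → ℕ) (p : MvPolynomial (Fin n) ℝ) (hp : p.totalDegree ≤ d)
    (h0 : ∀ y : Fin n → ℕ, (∀ i, y i < k i) → ∑ i, y i ≤ d →
      MvPolynomial.eval (fun i => (y i : ℝ)) p = 0) :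
    ∀ (s : ℕ) (y : Fin n → ℕ), ∑ i, y i = s → (∀ i, y i < k i) →
      MvPolynomial.eval (fun i => (y i : ℝ)) p = 0 := by
  intro s
  induction s using Nat.strong_induction_on with
  | _ s ih =>
    intro y hys hy
    rcases le_or_gt (∑ i, y i) d with h | h
    · exact h0 y hy h
    have key := alt_sum_poly p hp y h
    rw [Finset.sum_eq_single y] at key
    · simpa using key
    · intro z hz hne
      have hz' : ∀ i, z i ≤ y i := fun i => by
        have := Fintype.mem_piFinset.mp hz i
        rw [Finset.mem_range] at this; omega
      have hlt : ∑ i, z i < ∑ i, y i := by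
        obtain ⟨i, hi⟩ := Function.ne_iff.mp hne
        exact Finset.sum_lt_sum (fun i _ => hz' i) ⟨i, Finset.mem_univ i, by
          have := hz' i; omega⟩
      rw [ih _ (hys ▸ hlt) z rfl (fun i => (hz' i).trans_lt (hy i)), mul_zero]
    · intro hn
      exact absurd (Fintype.mem_piFinset.mpr fun i => by simp) hn

lemma block_bound (n : ℕ) (k : Fin n → ℕ) (hk : ∀ i, 2 ≤ k i)
    (N : ℕ) (hN : N = ∑ i, (k i - 1))
    (hSU1 : ∀ j, j < N / 2 → layerCard n k j < layerCard n k (j + 1)) (c : Fin n) :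
    2 * (k c - 1) ≤ N + 1 := by
  by_contra hcon
  have hsplit : (k c - 1) + ∑ i ∈ Finset.univ.erase c, (k i - 1) = N := by
    rw [hN]; exact Finset.add_sum_erase _ (fun i => k i - 1) (Finset.mem_univ c)
  set R := ∑ i ∈ Finset.univ.erase c, (k i - 1) with hR
  have hlt := hSU1 R (by omega)
  refine absurd hlt (not_lt.mpr ?_)
  unfold layerCard
  have hpos : ∀ x : ∀ i, Fin (k i), ∑ i, (x i : ℕ) = R + 1 → 1 ≤ (x c : ℕ) := by
    intro x hx
    have h1 : (x c : ℕ) + ∑ i ∈ Finset.univ.erase c, (x i : ℕ) = ∑ i, (x i : ℕ) :=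
      Finset.add_sum_erase _ (fun i => (x i : ℕ)) (Finset.mem_univ c)
    have h2 : ∑ i ∈ Finset.univ.erase c, (x i : ℕ) ≤ R :=
      Finset.sum_le_sum fun i _ => by have := (x i).2; omega
    omega
  refine Finset.card_le_card_of_injOn
    (fun x => Function.update x c ⟨(x c : ℕ) - 1, by have := (x c).2; omega⟩) ?_ ?_
  · intro x hx
    simp only [Finset.coe_filter, Finset.mem_univ, true_and, Set.mem_ofPred_eq] at hx ⊢
    have hp := hpos x hx
    have h1 : (x c : ℕ) + ∑ i ∈ Finset.univ.erase c, (x i : ℕ) = ∑ i, (x i : ℕ) :=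
      Finset.add_sum_erase _ (fun i => (x i : ℕ)) (Finset.mem_univ c)
    rw [← Finset.add_sum_erase _ _ (Finset.mem_univ c), Function.update_self]
    have h2 : ∑ i ∈ Finset.univ.erase c, ((Function.update x c
        ⟨(x c : ℕ) - 1, by have := (x c).2; omega⟩ i : Fin (k i)) : ℕ) =
        ∑ i ∈ Finset.univ.erase c, (x i : ℕ) := by
      refine Finset.sum_congr rfl fun i hi => ?_
      rw [Function.update_of_ne (Finset.ne_of_mem_erase hi)]
    rw [h2]
    simp only
    omega
  · intro x hx y hy hxy
    simp only [Finset.coe_filter, Finset.mem_univ, true_and, Set.mem_ofPred_eq] at hx hy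
    have hpx := hpos x hx
    have hpy := hpos y hy
    simp only at hxy
    funext i
    have hi := congrFun hxy i
    by_cases hic : i = c
    · subst hic
      simp only [Function.update_self, Fin.mk.injEq] at hi
      exact Fin.ext (by omega)
    · rwa [Function.update_of_ne hic, Function.update_of_ne hic] at hi

lemma fill_split {n : ℕ} (m : Fin n → ℕ) (j : ℕ) (S : Finset (Fin n)) :
    (∑ i ∈ S, m i ≤ j) ∨ ∃ (U : Finset (Fin n)) (c : Fin n), c ∉ U ∧ ∑ i ∈ U, m i ≤ j ∧
      j ≤ ∑ i ∈ U, m i + m c := by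
  induction S using Finset.induction_on with
  | empty => left; simp
  | insert c S hc ih =>
    rcases ih with h | h
    · rcases le_or_gt (∑ i ∈ insert c S, m i) j with h' | h'
      · exact Or.inl h'
      · right
        rw [Finset.sum_insert hc] at h'
        exact ⟨S, c, hc, h, by omega⟩
    · exact Or.inr h

lemma linform_deg {n : ℕ} (S : Finset (Fin n)) :
    (∑ i ∈ S, MvPolynomial.X i : MvPolynomial (Fin n) ℝ).totalDegree ≤ 1 :=
  MvPolynomial.totalDegree_finsetSum_le fun i _ => by simp

/-- separating polynomial -/
lemma separate {n : ℕ} (m : Fin n → ℕ) (i j : ℕ) (hij : i ≤ j)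
    (U W V : Finset (Fin n)) (hsum : ∀ f : Fin n → ℕ, ∑ t, f t =
      ∑ t ∈ U, f t + ∑ t ∈ W, f t + ∑ t ∈ V, f t)
    (hjN : j + i ≤ ∑ t, m t)
    (h1 : ∑ t ∈ U, m t ≤ j) (h2 : j ≤ ∑ t ∈ U, m t + ∑ t ∈ W, m t)
    (h3 : ∑ t ∈ W, m t + i ≤ ∑ t, m t) (x : Fin n → ℕ)
    (hxU : ∑ t ∈ U, x t = ∑ t ∈ U, m t) (hxW : ∑ t ∈ W, x t = j - ∑ t ∈ U, m t)
    (hxV : ∑ t ∈ V, x t = 0) :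
    ∃ p : MvPolynomial (Fin n) ℝ, p.totalDegree ≤ i ∧
      (∀ y : Fin n → ℕ, (∀ t, y t ≤ m t) → (∑ t, y t < i ∨ ∑ t, m t - i < ∑ t, y t) →
        MvPolynomial.eval (fun t => (y t : ℝ)) p = 0) ∧
      MvPolynomial.eval (fun t => (x t : ℝ)) p ≠ 0 := by
  have hs := hsum m
  have hle : ∀ (S : Finset (Fin n)) (y : Fin n → ℕ), (∀ t, y t ≤ m t) →
      ∑ t ∈ S, y t ≤ ∑ t ∈ S, m t := fun S y hy => Finset.sum_le_sum fun t _ => hy t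
  have hev : ∀ (S : Finset (Fin n)) (y : Fin n → ℕ),
      MvPolynomial.eval (fun t => (y t : ℝ)) (∑ i ∈ S, MvPolynomial.X i) =
        ((∑ t ∈ S, y t : ℕ) : ℝ) := by
    intro S y; simp
  generalize hα : ∑ t ∈ U, m t = α at *
  generalize hβ : ∑ t ∈ V, m t = β at *
  generalize hμ : ∑ t ∈ W, m t = μ at *
  obtain ⟨a, b, e, habe, ha, hb, he, hes, hbs⟩ : ∃ a b e : ℕ, a + b + e = i ∧ a + b ≤ α ∧
      b + e ≤ μ ∧ a + e ≤ β ∧ e ≤ j - α ∧ b ≤ α + μ - j :=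
    ⟨i - (i - β) - (i - α), i - β, i - α, by omega, by omega, by omega, by omega, by omega,
      by omega⟩
  obtain ⟨F, f1, f2, f3, -, -, f6⟩ := key_exists (α - a - b) (μ - b - e) (β - a - e) a b e
  rw [show α - a - b + a + b = α by omega] at f1 f6
  rw [show μ - b - e + b + e = μ by omega, show β - a - e + a + e = β by omega, habe] at f1
  obtain ⟨p, hp, hp'⟩ := f1.poly (∑ t ∈ U, MvPolynomial.X t) (∑ t ∈ W, MvPolynomial.X t)
    (∑ t ∈ V, MvPolynomial.X t) (linform_deg U) (linform_deg W) (linform_deg V)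
  refine ⟨p, hp, ?_, ?_⟩
  · intro y hy hyw
    have hU := hle U y hy
    have hW := hle W y hy
    have hV := hle V y hy
    rw [hα] at hU
    rw [hμ] at hW
    rw [hβ] at hV
    have hys := hsum y
    have e1 := hp' _ _ _ _ (hev U y) (hev W y) (hev V y)
    have e2 : F ((∑ t ∈ U, y t : ℕ) : ℤ) ((∑ t ∈ W, y t : ℕ) : ℤ) ((∑ t ∈ V, y t : ℕ) : ℤ) = 0 := by
      rcases hyw with h | h
      · exact f2 _ _ _ (by omega)
      · exact f3 _ _ _ (by omega)
    rw [e2] at e1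
    have c1 := (Nat.choose_pos hU).ne'
    have c2 := (Nat.choose_pos hW).ne'
    have c3 := (Nat.choose_pos hV).ne'
    refine (mul_eq_zero.mp e1.symm).resolve_left ?_
    exact mul_ne_zero (mul_ne_zero (by exact_mod_cast c1) (by exact_mod_cast c2))
      (by exact_mod_cast c3)
  · have e1 := hp' _ _ _ _ (hev U x) (hev W x) (hev V x)
    rw [hxU, hxW, hxV] at e1
    intro h0
    rw [h0, mul_zero, Nat.cast_zero, f6, bcz, if_pos (by omega)] at e1
    have c := (Nat.choose_pos (n := μ - b - e) (k := (((j - α : ℕ) : ℤ) - e).toNat) (by omega)).ne'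
    exact c (by exact_mod_cast e1)

lemma mem_grid_iff {n : ℕ} {k : Fin n → ℕ} {x : Fin n → ℝ} :
    x ∈ gridSetR n k ↔ ∃ y : Fin n → ℕ, (∀ i, y i < k i) ∧ x = fun i => (y i : ℝ) := by
  constructor
  · intro h
    choose y h1 h2 using h
    exact ⟨y, h1, funext h2⟩
  · rintro ⟨y, h1, rfl⟩ i
    exact ⟨y i, h1 i, rfl⟩

lemma mem_underline_iff {n : ℕ} {k : Fin n → ℕ} {E : Set ℕ} {x : Fin n → ℝ} :
    x ∈ underlineR n k E ↔
      ∃ y : Fin n → ℕ, (∀ i, y i < k i) ∧ ∑ i, y i ∈ E ∧ x = fun i => (y i : ℝ) := by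
  constructor
  · rintro ⟨h, e, he, hs⟩
    obtain ⟨y, h1, rfl⟩ := mem_grid_iff.mp h
    refine ⟨y, h1, ?_, rfl⟩
    have : ∑ i, y i = e := by
      simp only at hs
      exact_mod_cast hs
    rwa [this]
  · rintro ⟨y, h1, h2, rfl⟩
    exact ⟨mem_grid_iff.mpr ⟨y, h1, rfl⟩, _, h2, by simp⟩

/-- In a strictly unimodal uniform (SU²) grid, the degree-`d` Z*-closure of
`T_{N,i} = [0,i-1] ∪ [N-i+1,N]` equals `T_{N,i}` if `i ≤ d`, and all of `[0,N]` if `i > d`. -/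
theorem stmt_17 (n : ℕ) (k : Fin n → ℕ) (hk : ∀ i, 2 ≤ k i)
    (N : ℕ) (hN : N = ∑ i, (k i - 1))
    (hSU1 : ∀ j, j < N / 2 → layerCard n k j < layerCard n k (j + 1))
    (hSU2 : layerCard n k (N / 2) = layerCard n k ((N + 1) / 2))
    (hSU3 : ∀ j, (N + 1) / 2 ≤ j → j < N → layerCard n k (j + 1) < layerCard n k j)
    (d i : ℕ) (hdN : d ≤ N) (hiN : i ≤ N) :
    (i ≤ d → ZstarR n k N d {j | j ≤ N ∧ (j < i ∨ N - i < j)} =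
      {j | j ≤ N ∧ (j < i ∨ N - i < j)}) ∧
    (d < i → ZstarR n k N d {j | j ≤ N ∧ (j < i ∨ N - i < j)} = {j | j ≤ N}) := by
  constructor
  · intro hid
    ext j
    constructor
    · rintro ⟨hjN, hsub⟩
      refine ⟨hjN, ?_⟩
      by_contra hcon
      push Not at hcon
      obtain ⟨hij, hji⟩ := hcon
      suffices hex : ∃ (x : Fin n → ℕ) (p : MvPolynomial (Fin n) ℝ), (∀ t, x t < k t) ∧
          ∑ t, x t = j ∧ p.totalDegree ≤ i ∧
          (∀ y : Fin n → ℕ, (∀ t, y t ≤ k t - 1) → (∑ t, y t < i ∨ N - i < ∑ t, y t) →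
          MvPolynomial.eval (fun t => (y t : ℝ)) p = 0) ∧
          MvPolynomial.eval (fun t => (x t : ℝ)) p ≠ 0 by
        obtain ⟨x, p, hx, hxj, hp, hv, hne⟩ := hex
        have hmem := hsub (mem_underline_iff.mpr ⟨x, hx, hxj, rfl⟩)
        refine hne (hmem.2 p (hp.trans hid) ?_)
        intro a ha
        obtain ⟨y, hy, hyT, rfl⟩ := mem_underline_iff.mp ha
        exact hv y (fun t => by have := hy t; omega) hyT.2
      rcases fill_split (fun t => k t - 1) j Finset.univ with h | ⟨U, c, hc, hU1, hU2⟩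
      · have hjeq : j = N := by omega
        obtain ⟨p, hp, hp1, hp2⟩ := separate (fun t => k t - 1) i j hij Finset.univ ∅ ∅
          (by simp) (by omega) (by omega) (by simp; omega) (by simp; omega) (fun t => k t - 1) rfl
          (by simp; omega) (by simp)
        refine ⟨_, p, fun t => by have := hk t; omega, by omega, hp, ?_, hp2⟩
        rw [hN]; exact hp1
      · have hsum : ∀ f : Fin n → ℕ, ∑ t, f t = ∑ t ∈ U, f t + ∑ t ∈ {c}, f t +
            ∑ t ∈ (insert c U)ᶜ, f t := by
          intro f
          rw [← Finset.sum_add_sum_compl (insert c U), Finset.sum_insert hc, Finset.sum_singleton]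
          ring
        have hbb := block_bound n k hk N hN hSU1 c
        let x : Fin n → ℕ := fun t => if t ∈ U then k t - 1 else
          if t = c then j - ∑ t ∈ U, (k t - 1) else 0
        have hxU : ∑ t ∈ U, x t = ∑ t ∈ U, (k t - 1) :=
          Finset.sum_congr rfl fun t ht => by simp [x, ht]
        have hxW : ∑ t ∈ {c}, x t = j - ∑ t ∈ U, (k t - 1) := by simp [x, hc]
        have hxV : ∑ t ∈ (insert c U)ᶜ, x t = 0 := Finset.sum_eq_zero fun t ht => by
          simp only [Finset.mem_compl, Finset.mem_insert, not_or] at ht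
          simp [x, ht.1, ht.2]
        obtain ⟨p, hp, hp1, hp2⟩ := separate (fun t => k t - 1) i j hij U {c} (insert c U)ᶜ
          hsum (by omega) hU1 (by simpa using hU2) (by rw [Finset.sum_singleton]; omega) x hxU hxW hxV
        refine ⟨x, p, ?_, ?_, hp, ?_, hp2⟩
        · intro t
          have := hk t
          simp only [x]
          split_ifs with g1 g2
          · omega
          · subst g2
            omega
          · omega
        · rw [hsum, hxU, hxW, hxV]
          omega
        · rw [hN]; exact hp1
    · intro hj
      refine ⟨hj.1, ?_⟩
      intro x hx
      obtain ⟨y, hy, hyj, rfl⟩ := mem_underline_iff.mp hx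
      refine ⟨mem_grid_iff.mpr ⟨y, hy, rfl⟩, fun p _ hv => hv _ ?_⟩
      refine mem_underline_iff.mpr ⟨y, hy, ?_, rfl⟩
      rw [Set.mem_singleton_iff] at hyj
      rw [hyj]; exact hj
  · intro hdi
    ext j
    constructor
    · intro h; exact h.1
    · intro hj
      refine ⟨hj, ?_⟩
      intro x hx
      obtain ⟨y, hy, -, rfl⟩ := mem_underline_iff.mp hx
      refine ⟨mem_grid_iff.mpr ⟨y, hy, rfl⟩, fun p hp hv => ?_⟩
      refine vanish_all k p hp ?_ _ y rfl hy
      intro z hz hzd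
      refine hv _ (mem_underline_iff.mpr ⟨z, hz, ?_, rfl⟩)
      exact ⟨by omega, Or.inl (by omega)⟩
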